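/- There exists a real polynomial P₄ of degree at most 3 with leading coefficient 1/6 such that for all real x ≥ e^{32}: |T₄(x) − x·P₄(log x)| < 33.480 · x^{3/4} · (log x)^{3/4}. -/

import Mathlib

open Finset Real

/-- `dk k n` is the number of ways to write `n` as an ordered product of `k`
positive integers (the `k`-fold Dirichlet convolution of the constant
function `1`). -/
noncomputable def dk (k n : ℕ) : ℕ := (ArithmeticFunction.zeta ^ k) n

/-- `Tk k x = ∑_{n ≤ x} d_k(n)`. -/
noncomputable def Tk (k : ℕ) (x : ℝ) : ℝ := ∑ n ∈ Finset.Icc 1 ⌊x⌋₊, (dk k n : ℝ)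

open MeasureTheory

lemma dk_zero_right (k : ℕ) : dk k 0 = 0 := by simp [dk]

lemma dk_one_left {n : ℕ} (hn : n ≠ 0) : dk 1 n = 1 := by simp [dk, hn]

lemma Tk_mono (k : ℕ) : Monotone (Tk k) := fun _ _ h =>
  Finset.sum_le_sum_of_subset_of_nonneg
    (Finset.Icc_subset_Icc_right (Nat.floor_le_floor h)) fun _ _ _ => Nat.cast_nonneg _

lemma Tk_one (x : ℝ) : Tk 1 x = ⌊x⌋₊ := by
  have : ∀ n ∈ Finset.Icc 1 ⌊x⌋₊, (dk 1 n : ℝ) = 1 := fun n hn => by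
    rw [dk_one_left (by have := (Finset.mem_Icc.1 hn).1; omega), Nat.cast_one]
  simp [Tk, Finset.sum_congr rfl this]

lemma Tk_succ (k : ℕ) (x : ℝ) :
    Tk (k + 1) x = ∑ m ∈ Finset.Icc 1 ⌊x⌋₊, (dk k m : ℝ) * (⌊x / m⌋₊ : ℝ) := by
  have h := ArithmeticFunction.sum_Ioc_mul_zeta_eq_sum (ArithmeticFunction.zeta ^ k) ⌊x⌋₊
  simp only [Tk, dk, pow_succ]
  rw [← Nat.cast_sum]
  have e : Finset.Icc 1 ⌊x⌋₊ = Finset.Ioc 0 ⌊x⌋₊ := rfl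
  rw [e]
  simp only [Nat.floor_div_natCast]
  exact_mod_cast h

lemma Tk_div_eq_sum_ite (k : ℕ) {x : ℝ} (hx : 0 ≤ x) {n : ℕ} (hn : 1 ≤ n) :
    Tk k (x / n) = ∑ m ∈ Finset.Icc 1 ⌊x⌋₊, if n ≤ ⌊x / m⌋₊ then (dk k m : ℝ) else 0 := by
  rw [← Finset.sum_filter, Tk]
  refine Finset.sum_congr ?_ fun _ _ => rfl
  ext m
  have hn' : (0 : ℝ) < n := by exact_mod_cast hn
  simp only [Finset.mem_Icc, Finset.mem_filter]
  constructor
  · rintro ⟨h1, h2⟩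
    have hm : (0 : ℝ) < m := by exact_mod_cast h1
    rw [Nat.le_floor_iff (by positivity), le_div_iff₀ hn'] at h2
    refine ⟨⟨h1, Nat.le_floor ?_⟩, Nat.le_floor ?_⟩
    · have : (1 : ℝ) ≤ n := by exact_mod_cast hn
      nlinarith
    · rw [le_div_iff₀ hm]; linarith
  · rintro ⟨⟨h1, -⟩, h3⟩
    have hm : (0 : ℝ) < m := by exact_mod_cast h1
    rw [Nat.le_floor_iff (by positivity), le_div_iff₀ hm] at h3
    refine ⟨h1, Nat.le_floor ?_⟩
    rw [le_div_iff₀ hn']; linarith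

lemma Tk_succ_eq_sum_Tk_div (k : ℕ) {x : ℝ} (hx : 0 ≤ x) (N : ℕ) :
    Tk (k + 1) x = ∑ n ∈ Finset.Icc 1 N, Tk k (x / n) +
      ∑ m ∈ Finset.Icc 1 ⌊x / (N + 1 / 2)⌋₊, (dk k m : ℝ) * ((⌊x / m⌋₊ : ℝ) - N) := by
  have e1 : ∑ n ∈ Finset.Icc 1 N, Tk k (x / n) =
      ∑ m ∈ Finset.Icc 1 ⌊x⌋₊, (dk k m : ℝ) * (min N ⌊x / m⌋₊ : ℕ) := by
    rw [Finset.sum_congr rfl fun n hn => Tk_div_eq_sum_ite k hx (Finset.mem_Icc.1 hn).1,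
      Finset.sum_comm]
    refine Finset.sum_congr rfl fun m _ => ?_
    rw [← Finset.sum_filter, Finset.sum_const, nsmul_eq_mul, mul_comm]
    congr 2
    have : Finset.filter (fun n => n ≤ ⌊x / m⌋₊) (Finset.Icc 1 N) =
        Finset.Icc 1 (min N ⌊x / m⌋₊) := by
      ext n; simp only [Finset.mem_filter, Finset.mem_Icc]; omega
    rw [this, Nat.card_Icc]; omega
  have key : ∀ m : ℕ, 1 ≤ m → ((m : ℝ) ≤ x / (N + 1 / 2) ↔ (N : ℝ) + 1 / 2 ≤ x / m) := by
    intro m hm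
    have hm' : (0 : ℝ) < m := by exact_mod_cast hm
    rw [le_div_iff₀ (by positivity), le_div_iff₀ hm', mul_comm]
  have e2 : ∑ m ∈ Finset.Icc 1 ⌊x / (N + 1 / 2)⌋₊, (dk k m : ℝ) * ((⌊x / m⌋₊ : ℝ) - N) =
      ∑ m ∈ Finset.Icc 1 ⌊x⌋₊, (dk k m : ℝ) * ((⌊x / m⌋₊ : ℝ) - (min N ⌊x / m⌋₊ : ℕ)) := by
    have h1 : ∀ m ∈ Finset.Icc 1 ⌊x / (N + 1 / 2)⌋₊, (dk k m : ℝ) * ((⌊x / m⌋₊ : ℝ) - N) =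
        (dk k m : ℝ) * ((⌊x / m⌋₊ : ℝ) - (min N ⌊x / m⌋₊ : ℕ)) := by
      intro m hm
      rw [Finset.mem_Icc, Nat.le_floor_iff (by positivity)] at hm
      have := (key m hm.1).1 hm.2
      rw [min_eq_left (Nat.le_floor (by linarith))]
    rw [Finset.sum_congr rfl h1]
    rw [← Finset.sum_subset (s₁ := Finset.Icc 1 (min ⌊x / (N + 1 / 2)⌋₊ ⌊x⌋₊))
      (s₂ := Finset.Icc 1 ⌊x⌋₊) (Finset.Icc_subset_Icc_right (min_le_right _ _)),
      ← Finset.sum_subset (s₁ := Finset.Icc 1 (min ⌊x / (N + 1 / 2)⌋₊ ⌊x⌋₊))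
      (s₂ := Finset.Icc 1 ⌊x / (N + 1 / 2)⌋₊) (Finset.Icc_subset_Icc_right (min_le_left _ _))]
    · intro m hm hm'
      simp only [Finset.mem_Icc] at hm hm'
      have : ⌊x / m⌋₊ = 0 := by
        rw [Nat.floor_div_natCast, Nat.div_eq_of_lt (by omega)]
      simp [this]
    · intro m hm hm'
      simp only [Finset.mem_Icc] at hm hm'
      have h2 : ¬ (m : ℝ) ≤ x / (N + 1 / 2) := by
        intro h
        have := Nat.le_floor h
        omega
      rw [key m hm.1, not_le] at h2
      have : ⌊x / m⌋₊ ≤ N := by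
        by_contra! h
        have h3 := Nat.floor_le (show 0 ≤ x / m by positivity)
        have : ((N : ℝ) + 1) ≤ ⌊x / m⌋₊ := by exact_mod_cast h
        linarith
      rw [min_eq_right this, sub_self, mul_zero]
  rw [e1, e2, ← Finset.sum_add_distrib, Tk_succ]
  exact Finset.sum_congr rfl fun m _ => by ring

lemma sum_Icc_one_div_le {x : ℝ} (hx : 1 ≤ x) :
    ∑ n ∈ Finset.Icc 1 ⌊x⌋₊, 1 / (n : ℝ) ≤ 1 + Real.log x := by
  have h := harmonic_floor_le_one_add_log x hx
  rw [harmonic_eq_sum_Icc] at h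
  push_cast at h
  simpa [one_div] using h

lemma Tk_succ_le (k : ℕ) {x : ℝ} (hx : 1 ≤ x) :
    Tk (k + 1) x ≤ x * (1 + Real.log x) ^ k := by
  induction k generalizing x with
  | zero => simpa [Tk_one] using Nat.floor_le (zero_le_one.trans hx)
  | succ k ih =>
    have hx0 : 0 < x := by linarith
    have hl := Real.log_nonneg hx
    rw [Tk_succ_eq_sum_Tk_div (k + 1) hx0.le ⌊x⌋₊]
    have h0 : ⌊x / (⌊x⌋₊ + 1 / 2)⌋₊ ≤ 1 := by
      have h1 := Nat.lt_floor_add_one x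
      have h2 : (1 : ℝ) ≤ ⌊x⌋₊ := by exact_mod_cast (Nat.one_le_floor_iff x).2 hx
      refine Nat.lt_succ_iff.1 ((Nat.floor_lt (by positivity)).2 ?_)
      rw [div_lt_iff₀ (by positivity)]
      push_cast; linarith
    have h1 : ∑ m ∈ Finset.Icc 1 ⌊x / (⌊x⌋₊ + 1 / 2)⌋₊,
        (dk (k + 1) m : ℝ) * ((⌊x / m⌋₊ : ℝ) - ⌊x⌋₊) = 0 := by
      refine Finset.sum_eq_zero fun m hm => ?_
      rw [Finset.mem_Icc] at hm
      have : m = 1 := by omega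
      simp [this]
    rw [h1, add_zero]
    calc ∑ n ∈ Finset.Icc 1 ⌊x⌋₊, Tk (k + 1) (x / n)
        ≤ ∑ n ∈ Finset.Icc 1 ⌊x⌋₊, x * (1 + Real.log x) ^ k * (1 / (n : ℝ)) := by
          refine Finset.sum_le_sum fun n hn => ?_
          rw [Finset.mem_Icc, Nat.le_floor_iff hx0.le] at hn
          have hn1 : (1 : ℝ) ≤ n := by exact_mod_cast hn.1
          have h2 : 1 ≤ x / n := by rw [le_div_iff₀ (by linarith)]; linarith
          have h3 : Real.log (x / n) ≤ Real.log x :=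
            Real.log_le_log (by linarith) (div_le_self hx0.le hn1)
          have h4 := Real.log_nonneg h2
          calc _ ≤ x / n * (1 + Real.log (x / n)) ^ k := ih h2
            _ ≤ x / n * (1 + Real.log x) ^ k := by gcongr
            _ = _ := by ring
      _ ≤ x * (1 + Real.log x) ^ k * (1 + Real.log x) := by
          rw [← Finset.mul_sum]
          gcongr
          exact sum_Icc_one_div_le hx
      _ = _ := by ring

lemma abs_sub_sub_deriv_le {H h h' h'' : ℝ → ℝ} {c K : ℝ}
    (hH : ∀ t ∈ Set.Icc (c - 1 / 2) (c + 1 / 2), HasDerivAt H (h t) t)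
    (hh : ∀ t ∈ Set.Icc (c - 1 / 2) (c + 1 / 2), HasDerivAt h (h' t) t)
    (hh' : ∀ t ∈ Set.Icc (c - 1 / 2) (c + 1 / 2), HasDerivAt h' (h'' t) t)
    (hK : ∀ t ∈ Set.Icc (c - 1 / 2) (c + 1 / 2), |h'' t| ≤ K) :
    |H (c + 1 / 2) - H (c - 1 / 2) - h c| ≤ K / 4 := by
  have hc : c ∈ Set.Icc (c - 1 / 2) (c + 1 / 2) := ⟨by linarith, by linarith⟩
  have hK0 : 0 ≤ K := (abs_nonneg _).trans (hK c hc)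
  have b1 : ∀ s ∈ Set.Icc (c - 1 / 2) (c + 1 / 2), ∀ t ∈ Set.Icc (c - 1 / 2) (c + 1 / 2),
      |h' t - h' s| ≤ K * |t - s| := fun s hs t ht =>
    (convex_Icc _ _).norm_image_sub_le_of_norm_hasDerivWithin_le
      (fun x hx => (hh' x hx).hasDerivWithinAt) hK hs ht
  have b2 : ∀ v ∈ Set.Icc (0 : ℝ) (1 / 2), |h (c + v) + h (c - v) - 2 * h c| ≤ K / 2 := by
    intro v hv
    have mem : ∀ w ∈ Set.Icc (0 : ℝ) v, c + w ∈ Set.Icc (c - 1 / 2) (c + 1 / 2) ∧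
        c - w ∈ Set.Icc (c - 1 / 2) (c + 1 / 2) := fun w hw =>
      ⟨⟨by linarith [hw.1, hw.2, hv.2], by linarith [hw.1, hw.2, hv.2]⟩,
        ⟨by linarith [hw.1, hw.2, hv.2], by linarith [hw.1, hw.2, hv.2]⟩⟩
    have := (convex_Icc (0 : ℝ) v).norm_image_sub_le_of_norm_hasDerivWithin_le
      (f := fun w => h (c + w) + h (c - w)) (f' := fun w => h' (c + w) - h' (c - w))
      (C := K) (x := 0) (y := v)
      (fun w hw => by
        have d1 := (hh _ (mem w hw).1).comp w ((hasDerivAt_id w).const_add c)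
        have d2 := (hh _ (mem w hw).2).comp w ((hasDerivAt_id w).const_sub c)
        have d3 := d1.add d2
        convert! d3.hasDerivWithinAt using 1
        ring)
      (fun w hw => by
        refine (b1 _ (mem w hw).2 _ (mem w hw).1).trans ?_
        have : |c + w - (c - w)| ≤ 1 := by
          rw [abs_le]; constructor <;> linarith [hw.1, hw.2, hv.2]
        nlinarith)
      ⟨le_rfl, hv.1⟩ ⟨hv.1, le_rfl⟩
    rw [Real.norm_eq_abs, Real.norm_eq_abs, sub_zero v, abs_of_nonneg hv.1] at this
    have e : h (c + v) + h (c - v) - (h (c + 0) + h (c - 0)) =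
      h (c + v) + h (c - v) - 2 * h c := by rw [add_zero, sub_zero]; ring
    simp only [e] at this
    nlinarith [hv.2]
  have := (convex_Icc (0 : ℝ) (1 / 2)).norm_image_sub_le_of_norm_hasDerivWithin_le
      (f := fun v => H (c + v) - H (c - v) - 2 * v * h c)
      (f' := fun v => h (c + v) + h (c - v) - 2 * h c)
      (C := K / 2) (x := 0) (y := 1 / 2)
      (fun v hv => by
        have m1 : c + v ∈ Set.Icc (c - 1 / 2) (c + 1 / 2) :=
          ⟨by linarith [hv.1, hv.2], by linarith [hv.1, hv.2]⟩
        have m2 : c - v ∈ Set.Icc (c - 1 / 2) (c + 1 / 2) :=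
          ⟨by linarith [hv.1, hv.2], by linarith [hv.1, hv.2]⟩
        have d1 := (hH _ m1).comp v ((hasDerivAt_id v).const_add c)
        have d2 := (hH _ m2).comp v ((hasDerivAt_id v).const_sub c)
        have d3 := (d1.sub d2).sub (((hasDerivAt_id v).const_mul 2).mul_const (h c))
        convert! d3.hasDerivWithinAt using 1
        ring)
      b2 ⟨le_rfl, by norm_num⟩ ⟨by norm_num, le_rfl⟩
  have e : H (c + 1 / 2) - H (c - 1 / 2) - 2 * (1 / 2) * h c -
      (H (c + 0) - H (c - 0) - 2 * 0 * h c) = H (c + 1 / 2) - H (c - 1 / 2) - h c := by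
    rw [add_zero, sub_zero]; ring
  simp only [e, Real.norm_eq_abs] at this
  refine this.trans (le_of_eq ?_)
  norm_num
  ring

lemma exists_abs_sub_le_of_abs_succ_sub_le {u v : ℕ → ℝ}
    (h : ∀ n, 1 ≤ n → |u (n + 1) - u n| ≤ v n - v (n + 1))
    (hv : Filter.Tendsto v Filter.atTop (nhds 0)) :
    ∃ l, ∀ n, 1 ≤ n → |u n - l| ≤ v n := by
  have h1 : ∀ n, 1 ≤ n → ∀ m, n ≤ m → |u m - u n| ≤ v n - v m := by
    intro n hn m hm
    induction m, hm using Nat.le_induction with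
    | base => simp
    | succ m hm ih =>
      have := h m (hn.trans hm)
      rw [abs_le] at *
      constructor <;> linarith [this.1, this.2, ih.1, ih.2]
  have hc : CauchySeq u := by
    rw [Metric.cauchySeq_iff']
    intro ε hε
    have hv2 : Filter.Tendsto (fun n => |v n|) Filter.atTop (nhds 0) := by simpa using hv.abs
    obtain ⟨N, hN⟩ := Filter.eventually_atTop.1 (hv2.eventually (gt_mem_nhds (half_pos hε)))
    refine ⟨max N 1, fun n hn => ?_⟩
    have a1 := h1 (max N 1) (le_max_right _ _) n hn
    have a2 := hN _ (le_max_left N 1)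
    have a3 := hN n ((le_max_left N 1).trans hn)
    rw [Real.dist_eq]
    rw [abs_lt] at a2 a3
    linarith [a2.1, a2.2, a3.1, a3.2]
  obtain ⟨l, hl⟩ := cauchySeq_tendsto_of_complete hc
  refine ⟨l, fun n hn => ?_⟩
  have t1 : Filter.Tendsto (fun m => |u m - u n|) Filter.atTop (nhds |l - u n|) :=
    (hl.sub_const _).abs
  have t2 : Filter.Tendsto (fun m => v n - v m) Filter.atTop (nhds (v n)) := by
    simpa using hv.const_sub (v n)
  rw [abs_sub_comm]
  exact le_of_tendsto_of_tendsto t1 t2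
    (Filter.eventually_atTop.2 ⟨n, fun m hm => h1 n hn m hm⟩)

lemma exists_abs_sum_sub_le {H h h' h'' : ℝ → ℝ} {v : ℕ → ℝ} {K : ℕ → ℝ}
    (hH : ∀ t, 1 ≤ t → HasDerivAt H (h t) t)
    (hh : ∀ t, 1 ≤ t → HasDerivAt h (h' t) t)
    (hh' : ∀ t, 1 ≤ t → HasDerivAt h' (h'' t) t)
    (hK : ∀ n : ℕ, 1 ≤ n → ∀ t, (n : ℝ) + 1 / 2 ≤ t → |h'' t| ≤ K n)
    (hKv : ∀ n : ℕ, 1 ≤ n → K n / 4 ≤ v n - v (n + 1))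
    (hv : Filter.Tendsto v Filter.atTop (nhds 0)) :
    ∃ l, ∀ n : ℕ, 1 ≤ n → |∑ i ∈ Finset.Icc 1 n, h i - H (n + 1 / 2) - l| ≤ v n := by
  refine exists_abs_sub_le_of_abs_succ_sub_le
    (u := fun n : ℕ => ∑ i ∈ Finset.Icc 1 n, h i - H (n + 1 / 2)) (fun n hn => ?_) hv
  refine le_trans ?_ (hKv n hn)
  have hn' : (1 : ℝ) ≤ n := by exact_mod_cast hn
  have := abs_sub_sub_deriv_le (H := H) (h := h) (h' := h') (h'' := h'') (c := (n : ℝ) + 1)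
    (K := K n) (fun t ht => hH t (by linarith [ht.1])) (fun t ht => hh t (by linarith [ht.1]))
    (fun t ht => hh' t (by linarith [ht.1])) (fun t ht => hK n hn t (by linarith [ht.1]))
  rw [abs_sub_comm] at this
  convert! this using 2
  rw [Finset.sum_Icc_succ_top (by omega)]
  have e : (n : ℝ) + 1 - 1 / 2 = n + 1 / 2 := by ring
  rw [e]
  push_cast
  ring

lemma exists_abs_sum_one_div_sub_log_le : ∃ g : ℝ, ∀ N : ℕ, 1 ≤ N →
    |∑ n ∈ Finset.Icc 1 N, 1 / (n : ℝ) - Real.log (N + 1 / 2) - g| ≤ 1 / (4 * (N : ℝ) ^ 2) := by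
  refine exists_abs_sum_sub_le (H := Real.log) (h := fun t => 1 / t)
    (h' := fun t => -1 / t ^ 2) (h'' := fun t => 2 / t ^ 3) (v := fun n => 1 / (4 * (n : ℝ) ^ 2))
    (K := fun n => 2 / ((n : ℝ) + 1 / 2) ^ 3) ?_ ?_ ?_ ?_ ?_ ?_
  · intro t ht
    simpa using Real.hasDerivAt_log (by linarith : t ≠ 0)
  · intro t ht
    have h0 : t ≠ 0 := by linarith
    simpa [neg_div] using hasDerivAt_inv h0
  · intro t ht
    have h0 : t ≠ 0 := by linarith
    have := ((hasDerivAt_pow 2 t).inv (by positivity)).neg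
    convert! this using 1
    · ext s; simp [neg_div]
    · field_simp
      simp
  · intro n hn t ht
    have : (0 : ℝ) < t := lt_of_lt_of_le (by positivity) ht
    rw [abs_of_pos (by positivity)]
    gcongr
  · intro n hn
    have hn' : (1 : ℝ) ≤ n := by exact_mod_cast hn
    have e : 1 / (4 * (n : ℝ) ^ 2) - 1 / (4 * ((n + 1 : ℕ) : ℝ) ^ 2) =
        (2 * n + 1) / (4 * (n * (n + 1)) ^ 2) := by
      push_cast; field_simp; ring
    simp only [e]
    rw [div_div, div_le_div_iff₀ (by positivity) (by positivity)]
    have : ((n : ℝ) * (n + 1)) ^ 2 ≤ ((n + 1 / 2) ^ 2) ^ 2 := by gcongr; nlinarith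
    nlinarith
  · have := tendsto_one_div_atTop_nhds_zero_nat (𝕜 := ℝ)
    have h2 := (this.mul this).const_mul (1 / 4 : ℝ)
    simp only [mul_zero] at h2
    refine h2.congr fun n => ?_
    by_cases hn : (n : ℝ) = 0
    · simp [hn]
    · field_simp

lemma exists_abs_sum_log_div_sub_le : ∃ g : ℝ, ∀ N : ℕ, 1 ≤ N →
    |∑ n ∈ Finset.Icc 1 N, Real.log n / (n : ℝ) - Real.log (N + 1 / 2) ^ 2 / 2 - g|
      ≤ (3 / 4) / (N : ℝ) := by
  refine exists_abs_sum_sub_le (H := fun t => Real.log t ^ 2 / 2) (h := fun t => Real.log t / t)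
    (h' := fun t => (1 - Real.log t) / t ^ 2) (h'' := fun t => (2 * Real.log t - 3) / t ^ 3)
    (v := fun n => (3 / 4) / (n : ℝ)) (K := fun n => 3 / ((n : ℝ) + 1 / 2) ^ 2) ?_ ?_ ?_ ?_ ?_ ?_
  · intro t ht
    have h0 : t ≠ 0 := by linarith
    convert! ((Real.hasDerivAt_log h0).pow 2).div_const 2 using 1
    field_simp; simp; ring
  · intro t ht
    have h0 : t ≠ 0 := by linarith
    convert! (Real.hasDerivAt_log h0).div (hasDerivAt_id t) h0 using 1
    simp; field_simp
  · intro t ht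
    have h0 : t ≠ 0 := by linarith
    convert! ((Real.hasDerivAt_log h0).const_sub 1).div (hasDerivAt_pow 2 t) (by positivity) using 1
    field_simp; ring
  · intro n hn t ht
    have h0 : (0 : ℝ) < t := lt_of_lt_of_le (by positivity) ht
    have hn' : (1 : ℝ) ≤ n := by exact_mod_cast hn
    have h1 := Real.log_le_sub_one_of_pos h0
    have h2 := Real.log_nonneg (by linarith : 1 ≤ t)
    have h3 : |2 * Real.log t - 3| ≤ 3 * t := by rw [abs_le]; constructor <;> linarith
    rw [abs_div, abs_of_pos (by positivity : 0 < t ^ 3)]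
    calc _ ≤ 3 * t / t ^ 3 := by gcongr
      _ = 3 / t ^ 2 := by field_simp
      _ ≤ _ := by gcongr
  · intro n hn
    have hn' : (1 : ℝ) ≤ n := by exact_mod_cast hn
    have e : (3 / 4) / (n : ℝ) - (3 / 4) / ((n + 1 : ℕ) : ℝ) = 3 / (4 * (n * (n + 1))) := by
      push_cast; field_simp; ring
    simp only [e]
    rw [div_div, div_le_div_iff₀ (by positivity) (by positivity)]
    nlinarith
  · exact tendsto_const_div_atTop_nhds_zero_nat _

lemma exists_abs_sum_log_sq_div_sub_le : ∃ g : ℝ, ∀ N : ℕ, 1 ≤ N →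
    |∑ n ∈ Finset.Icc 1 N, Real.log n ^ 2 / (n : ℝ) - Real.log (N + 1 / 2) ^ 3 / 3 - g|
      ≤ (5 / 2) / (N : ℝ) := by
  refine exists_abs_sum_sub_le (H := fun t => Real.log t ^ 3 / 3)
    (h := fun t => Real.log t ^ 2 / t)
    (h' := fun t => (2 * Real.log t - Real.log t ^ 2) / t ^ 2)
    (h'' := fun t => (2 - 6 * Real.log t + 2 * Real.log t ^ 2) / t ^ 3)
    (v := fun n => (5 / 2) / (n : ℝ)) (K := fun n => 10 / ((n : ℝ) + 1 / 2) ^ 2) ?_ ?_ ?_ ?_ ?_ ?_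
  · intro t ht
    have h0 : t ≠ 0 := by linarith
    convert! ((Real.hasDerivAt_log h0).pow 3).div_const 3 using 1
    field_simp; simp; ring
  · intro t ht
    have h0 : t ≠ 0 := by linarith
    convert! ((Real.hasDerivAt_log h0).pow 2).div (hasDerivAt_id t) h0 using 1
    simp; field_simp
  · intro t ht
    have h0 : t ≠ 0 := by linarith
    convert! (((Real.hasDerivAt_log h0).const_mul 2).sub ((Real.hasDerivAt_log h0).pow 2)).div
      (hasDerivAt_pow 2 t) (by positivity) using 1
    simp; field_simp; ring
  · intro n hn t ht
    have h0 : (0 : ℝ) < t := lt_of_lt_of_le (by positivity) ht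
    have hn' : (1 : ℝ) ≤ n := by exact_mod_cast hn
    have h1 := Real.log_le_sub_one_of_pos h0
    have h2 := Real.log_nonneg (by linarith : 1 ≤ t)
    have h4 : Real.log t ^ 2 ≤ 4 * t := by
      have := Real.log_le_sub_one_of_pos (Real.sqrt_pos.2 h0)
      rw [Real.log_sqrt h0.le] at this
      nlinarith [Real.sq_sqrt h0.le, Real.sqrt_nonneg t]
    have h3 : |2 - 6 * Real.log t + 2 * Real.log t ^ 2| ≤ 10 * t := by
      rw [abs_le]; constructor <;> nlinarith
    rw [abs_div, abs_of_pos (by positivity : 0 < t ^ 3)]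
    calc _ ≤ 10 * t / t ^ 3 := by gcongr
      _ = 10 / t ^ 2 := by field_simp
      _ ≤ _ := by gcongr
  · intro n hn
    have hn' : (1 : ℝ) ≤ n := by exact_mod_cast hn
    have e : (5 / 2) / (n : ℝ) - (5 / 2) / ((n + 1 : ℕ) : ℝ) = 10 / (4 * (n * (n + 1))) := by
      push_cast; field_simp; ring
    simp only [e]
    rw [div_div, div_le_div_iff₀ (by positivity) (by positivity)]
    nlinarith
  · exact tendsto_const_div_atTop_nhds_zero_nat _

lemma integrableOn_Tk_div_sq (k : ℕ) (B : ℝ) :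
    IntegrableOn (fun u : ℝ => Tk k u / u ^ 2) (Set.Ioc 1 B) := by
  have h0 : ContinuousOn (fun u : ℝ => 1 / u ^ 2) (Set.Icc 1 B) :=
    continuousOn_const.div (continuousOn_id.pow 2) fun u hu => by
      have := hu.1
      positivity
  have := integrableOn_mul_sum_Icc (m := 1) (fun n => (dk k n : ℝ)) zero_le_one
    h0.integrableOn_Icc
  refine (this.mono_set Set.Ioc_subset_Icc_self).congr_fun (fun u _ => ?_) measurableSet_Ioc
  simp only [Tk]; ring

lemma sum_dk_div_eq (k : ℕ) (B : ℝ) :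
    ∑ m ∈ Finset.Icc 1 ⌊B⌋₊, (dk k m : ℝ) * (1 / m) =
      Tk k B / B + ∫ u in Set.Ioc 1 B, Tk k u / u ^ 2 := by
  have e : ∀ n : ℕ, ∑ i ∈ Finset.Icc 0 n, (dk k i : ℝ) = ∑ i ∈ Finset.Icc 1 n, (dk k i : ℝ) := by
    intro n
    rw [Finset.Icc_eq_cons_Ioc (Nat.zero_le n), Finset.sum_cons, dk_zero_right, Nat.cast_zero,
      zero_add]
    rfl
  have hd : ∀ u ∈ Set.Icc 1 B, HasDerivAt (fun u : ℝ => u⁻¹) (-(u ^ 2)⁻¹) u := fun u hu =>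
    hasDerivAt_inv (by linarith [hu.1])
  have h := sum_mul_eq_sub_integral_mul₀ (f := fun u : ℝ => u⁻¹) (fun n => (dk k n : ℝ))
    (by simp [dk_zero_right]) B (fun u hu => (hd u hu).differentiableAt) (by
      refine IntegrableOn.congr_fun (f := fun u : ℝ => -(u ^ 2)⁻¹) ?_
        (fun u hu => ((hd u hu).deriv).symm) measurableSet_Icc
      refine ContinuousOn.integrableOn_Icc ?_
      refine ((continuousOn_id.pow 2).inv₀ fun u hu => ?_).neg
      exact pow_ne_zero 2 (by linarith [hu.1] : u ≠ 0))
  have e1 : ∑ m ∈ Finset.Icc 1 ⌊B⌋₊, (dk k m : ℝ) * (1 / m) =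
      ∑ m ∈ Finset.Icc 0 ⌊B⌋₊, ((m : ℝ))⁻¹ * (dk k m : ℝ) := by
    rw [Finset.Icc_eq_cons_Ioc (Nat.zero_le ⌊B⌋₊), Finset.sum_cons, dk_zero_right, Nat.cast_zero,
      mul_zero, zero_add]
    exact Finset.sum_congr rfl fun m _ => by ring
  have e2 : ∫ u in Set.Ioc 1 B, deriv (fun u : ℝ => u⁻¹) u *
      ∑ i ∈ Finset.Icc 0 ⌊u⌋₊, (dk k i : ℝ) = - ∫ u in Set.Ioc 1 B, Tk k u / u ^ 2 := by
    rw [← integral_neg]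
    refine setIntegral_congr_fun measurableSet_Ioc fun u hu => ?_
    simp only [(hd u ⟨hu.1.le, hu.2⟩).deriv, e, Tk]
    ring
  rw [e1, h, e2, e, Tk]
  ring

lemma hasDerivAt_cubic_log (a b c : ℝ) {u : ℝ} (hu : u ≠ 0) :
    HasDerivAt (fun u => a / 3 * Real.log u ^ 3 + b / 2 * Real.log u ^ 2 + c * Real.log u)
      ((a * Real.log u ^ 2 + b * Real.log u + c) / u) u := by
  have h := Real.hasDerivAt_log hu
  convert! (((h.pow 3).const_mul (a / 3)).add ((h.pow 2).const_mul (b / 2))).add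
    (h.const_mul c) using 1
  field_simp
  push_cast
  ring

lemma continuousOn_quadratic_log_div (a b c B : ℝ) :
    ContinuousOn (fun u : ℝ => (a * Real.log u ^ 2 + b * Real.log u + c) / u) (Set.Icc 1 B) := by
  have hl : ContinuousOn Real.log (Set.Icc 1 B) :=
    Real.continuousOn_log.mono fun u hu => by
      have := hu.1
      simp only [Set.mem_compl_iff, Set.mem_singleton_iff]; linarith
  refine ContinuousOn.div (by fun_prop) continuousOn_id fun u hu => ?_
  have := hu.1
  linarith

lemma integral_quadratic_log_div (a b c : ℝ) {B : ℝ} (hB : 1 ≤ B) :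
    ∫ u in Set.Ioc 1 B, (a * Real.log u ^ 2 + b * Real.log u + c) / u =
      a / 3 * Real.log B ^ 3 + b / 2 * Real.log B ^ 2 + c * Real.log B := by
  rw [← intervalIntegral.integral_of_le hB,
    intervalIntegral.integral_eq_sub_of_hasDerivAt
      (f := fun u => a / 3 * Real.log u ^ 3 + b / 2 * Real.log u ^ 2 + c * Real.log u)]
  · simp
  · intro u hu
    rw [Set.uIcc_of_le hB] at hu
    exact hasDerivAt_cubic_log a b c (by linarith [hu.1])
  · refine ContinuousOn.intervalIntegrable ?_
    rw [Set.uIcc_of_le hB]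
    exact continuousOn_quadratic_log_div a b c B

/-- The error term of `Tk k` with respect to `u * (a * log u ^ 2 + b * log u + c)`. -/
noncomputable def TkErr (k : ℕ) (a b c u : ℝ) : ℝ :=
  Tk k u - u * (a * Real.log u ^ 2 + b * Real.log u + c)

lemma integrableOn_Ioc_TkErr_div_sq (k : ℕ) (a b c B : ℝ) :
    IntegrableOn (fun u => TkErr k a b c u / u ^ 2) (Set.Ioc 1 B) := by
  refine ((integrableOn_Tk_div_sq k B).sub
    ((continuousOn_quadratic_log_div a b c B).integrableOn_Icc.mono_set
      Set.Ioc_subset_Icc_self)).congr_fun (fun u hu => ?_) measurableSet_Ioc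
  have : 0 < u := by linarith [hu.1]
  simp only [TkErr, Pi.sub_apply]
  field_simp

lemma integral_Tk_div_sq (k : ℕ) (a b c : ℝ) {B : ℝ} (hB : 1 ≤ B) :
    ∫ u in Set.Ioc 1 B, Tk k u / u ^ 2 =
      a / 3 * Real.log B ^ 3 + b / 2 * Real.log B ^ 2 + c * Real.log B +
        ∫ u in Set.Ioc 1 B, TkErr k a b c u / u ^ 2 := by
  rw [← integral_quadratic_log_div a b c hB, ← integral_add
    ((continuousOn_quadratic_log_div a b c B).integrableOn_Icc.mono_set
      Set.Ioc_subset_Icc_self) (integrableOn_Ioc_TkErr_div_sq k a b c B)]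
  refine setIntegral_congr_fun measurableSet_Ioc fun u hu => ?_
  have : 0 < u := by linarith [hu.1]
  simp only [TkErr]
  field_simp
  ring

lemma norm_TkErr_div_sq_le {k : ℕ} {a b c κ θ u : ℝ} (hu : 0 < u)
    (h : |TkErr k a b c u| ≤ κ * u ^ θ) :
    ‖TkErr k a b c u / u ^ 2‖ ≤ κ * u ^ (θ - 2) := by
  rw [Real.norm_eq_abs, abs_div, abs_of_pos (by positivity : 0 < u ^ 2), Real.rpow_sub hu,
    Real.rpow_two, ← mul_div_assoc]
  gcongr

lemma integrableOn_Ioi_TkErr_div_sq {k : ℕ} {a b c κ θ U : ℝ} (hU : 1 ≤ U) (hθ : θ < 1)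
    (h : ∀ u, U ≤ u → |TkErr k a b c u| ≤ κ * u ^ θ) :
    IntegrableOn (fun u => TkErr k a b c u / u ^ 2) (Set.Ioi 1) := by
  rw [← Set.Ioc_union_Ioi_eq_Ioi hU]
  refine (integrableOn_Ioc_TkErr_div_sq k a b c U).union ?_
  refine Integrable.mono' (g := fun u : ℝ => κ * u ^ (θ - 2))
    ((integrableOn_Ioi_rpow_of_lt (by linarith) (by linarith)).const_mul κ) ?_ ?_
  · have : Measurable fun u => TkErr k a b c u / u ^ 2 := by
      have := (Tk_mono k).measurable
      unfold TkErr
      fun_prop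
    exact this.aestronglyMeasurable
  · refine (ae_restrict_iff' measurableSet_Ioi).2 (Filter.Eventually.of_forall fun u hu => ?_)
    have hu : U < u := hu
    exact norm_TkErr_div_sq_le (by linarith) (h u hu.le)

lemma abs_integral_Ioi_TkErr_div_sq_le {k : ℕ} {a b c κ θ B : ℝ} (hB : 1 ≤ B) (hθ : θ < 1)
    (h : ∀ u, B ≤ u → |TkErr k a b c u| ≤ κ * u ^ θ) :
    |∫ u in Set.Ioi B, TkErr k a b c u / u ^ 2| ≤ κ * B ^ (θ - 1) / (1 - θ) := by
  have hB0 : 0 < B := by linarith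
  have := norm_integral_le_of_norm_le (μ := volume.restrict (Set.Ioi B))
    (f := fun u => TkErr k a b c u / u ^ 2) (g := fun u : ℝ => κ * u ^ (θ - 2))
    ((integrableOn_Ioi_rpow_of_lt (by linarith) hB0).const_mul κ)
    ((ae_restrict_iff' measurableSet_Ioi).2 (Filter.Eventually.of_forall fun u hu => by
      have hu : B < u := hu
      exact norm_TkErr_div_sq_le (by linarith) (h u hu.le)))
  rw [integral_const_mul, integral_Ioi_rpow_of_lt (by linarith) hB0, Real.norm_eq_abs] at this
  refine this.trans (le_of_eq ?_)
  have e : θ - 2 + 1 = θ - 1 := by ring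
  have h1 : θ - 1 ≠ 0 := by linarith
  have h2 : 1 - θ ≠ 0 := by linarith
  rw [e]
  field_simp
  ring

lemma sum_div_rpow_le {x θ : ℝ} (hx : 0 ≤ x) (hθ0 : 0 ≤ θ) (hθ : θ < 1) (N : ℕ) :
    ∑ n ∈ Finset.Icc 1 N, (x / (n : ℝ)) ^ θ ≤ x ^ θ * (N : ℝ) ^ (1 - θ) / (1 - θ) := by
  have h1 : 0 < 1 - θ := by linarith
  induction N with
  | zero => simp [Real.zero_rpow h1.ne']
  | succ N ih =>
    rw [Finset.sum_Icc_succ_top (by omega)]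
    set M : ℝ := ((N + 1 : ℕ) : ℝ) with hM
    have hM0 : 0 < M := by positivity
    have hNM : (N : ℝ) = M * (1 + -(1 / M)) := by
      rw [mul_add, mul_neg, mul_one_div_cancel hM0.ne', hM]; push_cast; ring
    have hM1 : 1 / M ≤ 1 := by
      rw [div_le_one hM0, hM]; exact_mod_cast Nat.succ_le_succ (Nat.zero_le N)
    have hb := rpow_one_add_le_one_add_mul_self (s := -(1 / M)) (by linarith) h1.le
      (by linarith : 1 - θ ≤ 1)
    have h2 : (N : ℝ) ^ (1 - θ) ≤ M ^ (1 - θ) - (1 - θ) * M ^ (-θ) := by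
      rw [hNM, Real.mul_rpow hM0.le (by linarith)]
      have e : M ^ (-θ) = M ^ (1 - θ) * (1 / M) := by
        rw [sub_eq_add_neg, Real.rpow_add hM0, Real.rpow_one]; field_simp
      calc _ ≤ M ^ (1 - θ) * (1 + (1 - θ) * -(1 / M)) := by gcongr
        _ = _ := by rw [e]; ring
    have h3 : (x / M) ^ θ = x ^ θ * M ^ (-θ) := by
      rw [Real.div_rpow hx hM0.le, Real.rpow_neg hM0.le, div_eq_mul_inv]
    rw [h3]
    calc _ ≤ x ^ θ * (N : ℝ) ^ (1 - θ) / (1 - θ) + x ^ θ * M ^ (-θ) := by gcongr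
      _ ≤ x ^ θ * (M ^ (1 - θ) - (1 - θ) * M ^ (-θ)) / (1 - θ) + x ^ θ * M ^ (-θ) := by gcongr
      _ = _ := by field_simp; ring

lemma abs_Tk_succ_sub_le {k : ℕ} {a b c κ θ g₀ g₁ g₂ : ℝ}
    (hg₀ : ∀ N : ℕ, 1 ≤ N → |∑ n ∈ Finset.Icc 1 N, 1 / (n : ℝ) - Real.log (N + 1 / 2) - g₀|
      ≤ 1 / (4 * (N : ℝ) ^ 2))
    (hg₁ : ∀ N : ℕ, 1 ≤ N →
      |∑ n ∈ Finset.Icc 1 N, Real.log n / (n : ℝ) - Real.log (N + 1 / 2) ^ 2 / 2 - g₁|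
        ≤ (3 / 4) / (N : ℝ))
    (hg₂ : ∀ N : ℕ, 1 ≤ N →
      |∑ n ∈ Finset.Icc 1 N, Real.log n ^ 2 / (n : ℝ) - Real.log (N + 1 / 2) ^ 3 / 3 - g₂|
        ≤ (5 / 2) / (N : ℝ))
    (hint : IntegrableOn (fun u => TkErr k a b c u / u ^ 2) (Set.Ioi 1))
    {x : ℝ} {N : ℕ} (hN : 1 ≤ N) (hx : (N : ℝ) + 1 / 2 ≤ x) (hθ0 : 0 ≤ θ) (hθ : θ < 1)
    (hκ : 0 ≤ κ)
    (hΔ : ∀ u, x / ((N : ℝ) + 1 / 2) ≤ u → |TkErr k a b c u| ≤ κ * u ^ θ) :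
    |Tk (k + 1) x - x * (a / 3 * Real.log x ^ 3 + (b / 2 + g₀ * a) * Real.log x ^ 2 +
        (c + g₀ * b - 2 * g₁ * a) * Real.log x +
        ((∫ u in Set.Ioi 1, TkErr k a b c u / u ^ 2) + g₀ * c - g₁ * b + g₂ * a))| ≤
      2 * κ / (1 - θ) * (x ^ θ * ((N : ℝ) + 1 / 2) ^ (1 - θ)) +
        Tk k (x / ((N : ℝ) + 1 / 2)) / 2 +
        x * (|a * Real.log x ^ 2 + b * Real.log x + c| / (4 * (N : ℝ) ^ 2) +
          |2 * a * Real.log x + b| * ((3 / 4) / N) + |a| * ((5 / 2) / N)) := by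
  have hN1 : (1 : ℝ) ≤ N := by exact_mod_cast hN
  set A : ℝ := (N : ℝ) + 1 / 2 with hA
  have hA0 : 0 < A := by linarith
  have hx0 : 0 < x := by linarith
  set B := x / A with hBdef
  have hB : 1 ≤ B := by rw [hBdef, le_div_iff₀ hA0]; linarith
  have hB0 : 0 < B := by linarith
  have hlogB : Real.log B = Real.log x - Real.log A := Real.log_div hx0.ne' hA0.ne'
  have h1θ : 0 < 1 - θ := by linarith
  set L := Real.log x with hL
  -- the part with small first factor
  have s1 : ∑ n ∈ Finset.Icc 1 N, Tk k (x / n) =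
      x * ((a * L ^ 2 + b * L + c) * ∑ n ∈ Finset.Icc 1 N, 1 / (n : ℝ)
        - (2 * a * L + b) * ∑ n ∈ Finset.Icc 1 N, Real.log n / (n : ℝ)
        + a * ∑ n ∈ Finset.Icc 1 N, Real.log n ^ 2 / (n : ℝ)) +
      ∑ n ∈ Finset.Icc 1 N, TkErr k a b c (x / n) := by
    rw [Finset.mul_sum, Finset.mul_sum, Finset.mul_sum, ← Finset.sum_sub_distrib,
      ← Finset.sum_add_distrib, Finset.mul_sum, ← Finset.sum_add_distrib]
    refine Finset.sum_congr rfl fun n hn => ?_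
    have hn0 : (n : ℝ) ≠ 0 := by
      have := (Finset.mem_Icc.1 hn).1
      positivity
    rw [TkErr, Real.log_div hx0.ne' hn0, ← hL]
    ring
  have s1' : |∑ n ∈ Finset.Icc 1 N, TkErr k a b c (x / n)| ≤
      κ / (1 - θ) * (x ^ θ * A ^ (1 - θ)) := by
    calc _ ≤ ∑ n ∈ Finset.Icc 1 N, |TkErr k a b c (x / n)| := Finset.abs_sum_le_sum_abs _ _
      _ ≤ ∑ n ∈ Finset.Icc 1 N, κ * (x / (n : ℝ)) ^ θ := by
        refine Finset.sum_le_sum fun n hn => hΔ _ ?_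
        rw [Finset.mem_Icc] at hn
        have hn0 : (0 : ℝ) < n := by exact_mod_cast hn.1
        have : (n : ℝ) ≤ A := by
          have : (n : ℝ) ≤ N := by exact_mod_cast hn.2
          linarith
        rw [hBdef]
        gcongr
      _ ≤ κ * (x ^ θ * (N : ℝ) ^ (1 - θ) / (1 - θ)) := by
        rw [← Finset.mul_sum]
        gcongr
        exact sum_div_rpow_le hx0.le hθ0 hθ N
      _ ≤ κ * (x ^ θ * A ^ (1 - θ) / (1 - θ)) := by
        gcongr
        linarith
      _ = _ := by ring
  -- the part with small second factor
  have s2 : |∑ m ∈ Finset.Icc 1 ⌊B⌋₊, (dk k m : ℝ) * ((⌊x / m⌋₊ : ℝ) - N) -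
      ∑ m ∈ Finset.Icc 1 ⌊B⌋₊, (dk k m : ℝ) * (x / m - A)| ≤ Tk k B / 2 := by
    rw [← Finset.sum_sub_distrib, Tk, Finset.sum_div]
    refine (Finset.abs_sum_le_sum_abs _ _).trans (Finset.sum_le_sum fun m _ => ?_)
    rw [← mul_sub, abs_mul, Nat.abs_cast, div_eq_mul_one_div (dk k m : ℝ) 2]
    gcongr
    have h1 := Nat.floor_le (show 0 ≤ x / m by positivity)
    have h2 := Nat.lt_floor_add_one (x / m)
    rw [abs_le, hA]
    constructor <;> linarith
  set C := ∫ u in Set.Ioi 1, TkErr k a b c u / u ^ 2 with hC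
  have s3 : ∑ m ∈ Finset.Icc 1 ⌊B⌋₊, (dk k m : ℝ) * (x / m - A) =
      x * (a / 3 * Real.log B ^ 3 + b / 2 * Real.log B ^ 2 + c * Real.log B +
        (C - ∫ u in Set.Ioi B, TkErr k a b c u / u ^ 2)) := by
    have e : C = (∫ u in Set.Ioc 1 B, TkErr k a b c u / u ^ 2) +
        ∫ u in Set.Ioi B, TkErr k a b c u / u ^ 2 := by
      rw [hC, ← Set.Ioc_union_Ioi_eq_Ioi hB]
      exact setIntegral_union (Set.disjoint_left.2 fun u h1 h2 => not_lt.2 h1.2 h2)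
        measurableSet_Ioi (integrableOn_Ioc_TkErr_div_sq k a b c B)
        (hint.mono_set (Set.Ioi_subset_Ioi hB))
    rw [e, add_sub_cancel_right, ← integral_Tk_div_sq k a b c hB]
    have e2 : ∑ m ∈ Finset.Icc 1 ⌊B⌋₊, (dk k m : ℝ) * (x / m - A) =
        x * ∑ m ∈ Finset.Icc 1 ⌊B⌋₊, (dk k m : ℝ) * (1 / m) - A * Tk k B := by
      rw [Tk, Finset.mul_sum, Finset.mul_sum, ← Finset.sum_sub_distrib]
      exact Finset.sum_congr rfl fun m _ => by ring
    rw [e2, sum_dk_div_eq k B, hBdef]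
    field_simp
    ring
  have s3' : |x * ∫ u in Set.Ioi B, TkErr k a b c u / u ^ 2| ≤
      κ / (1 - θ) * (x ^ θ * A ^ (1 - θ)) := by
    rw [abs_mul, abs_of_pos hx0]
    calc _ ≤ x * (κ * B ^ (θ - 1) / (1 - θ)) := by
          gcongr
          exact abs_integral_Ioi_TkErr_div_sq_le hB hθ hΔ
      _ = _ := by
          have e : A ^ (1 - θ) = (A ^ (θ - 1))⁻¹ := by
            rw [← Real.rpow_neg hA0.le, neg_sub]
          rw [hBdef, Real.div_rpow hx0.le hA0.le, e, Real.rpow_sub hx0, Real.rpow_one]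
          field_simp
  set e₀ := ∑ n ∈ Finset.Icc 1 N, 1 / (n : ℝ) - Real.log A - g₀ with he₀
  set e₁ := ∑ n ∈ Finset.Icc 1 N, Real.log n / (n : ℝ) - Real.log A ^ 2 / 2 - g₁ with he₁
  set e₂ := ∑ n ∈ Finset.Icc 1 N, Real.log n ^ 2 / (n : ℝ) - Real.log A ^ 3 / 3 - g₂ with he₂
  have b0 : |x * ((a * L ^ 2 + b * L + c) * e₀)| ≤
      x * (|a * L ^ 2 + b * L + c| / (4 * (N : ℝ) ^ 2)) := by
    rw [abs_mul, abs_of_pos hx0, abs_mul, div_eq_mul_one_div]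
    gcongr
    exact hg₀ N hN
  have b1 : |x * ((2 * a * L + b) * e₁)| ≤ x * (|2 * a * L + b| * ((3 / 4) / N)) := by
    rw [abs_mul, abs_of_pos hx0, abs_mul]
    gcongr
    exact hg₁ N hN
  have b2 : |x * (a * e₂)| ≤ x * (|a| * ((5 / 2) / N)) := by
    rw [abs_mul, abs_of_pos hx0, abs_mul]
    gcongr
    exact hg₂ N hN
  have key : Tk (k + 1) x - x * (a / 3 * L ^ 3 + (b / 2 + g₀ * a) * L ^ 2 +
        (c + g₀ * b - 2 * g₁ * a) * L + (C + g₀ * c - g₁ * b + g₂ * a)) =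
      ∑ n ∈ Finset.Icc 1 N, TkErr k a b c (x / n) +
      (∑ m ∈ Finset.Icc 1 ⌊B⌋₊, (dk k m : ℝ) * ((⌊x / m⌋₊ : ℝ) - N) -
        ∑ m ∈ Finset.Icc 1 ⌊B⌋₊, (dk k m : ℝ) * (x / m - A)) -
      x * (∫ u in Set.Ioi B, TkErr k a b c u / u ^ 2) +
      (x * ((a * L ^ 2 + b * L + c) * e₀) - x * ((2 * a * L + b) * e₁) + x * (a * e₂)) := by
    rw [Tk_succ_eq_sum_Tk_div k hx0.le N, s1, s3, hlogB, he₀, he₁, he₂]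
    ring
  rw [key]
  have e : 2 * κ / (1 - θ) * (x ^ θ * A ^ (1 - θ)) = κ / (1 - θ) * (x ^ θ * A ^ (1 - θ)) +
    κ / (1 - θ) * (x ^ θ * A ^ (1 - θ)) := by ring
  rw [e, mul_add, mul_add]
  rw [abs_le] at *
  constructor <;> linarith [s1'.1, s1'.2, s2.1, s2.2, s3'.1, s3'.2, b0.1, b0.2, b1.1, b1.2,
    b2.1, b2.2]

lemma abs_TkErr_one_le {u : ℝ} (hu : 0 ≤ u) : |TkErr 1 0 0 1 u| ≤ 1 * u ^ (0 : ℝ) := by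
  have h1 := Nat.floor_le hu
  have h2 := Nat.lt_floor_add_one u
  rw [TkErr, Tk_one, Real.rpow_zero, abs_le]
  constructor <;> linarith

lemma le_ceil_of_pos {X : ℝ} (hX : 0 < X) :
    1 ≤ ⌈X⌉₊ ∧ X ≤ (⌈X⌉₊ : ℝ) ∧ (⌈X⌉₊ : ℝ) ≤ X + 1 :=
  ⟨Nat.one_le_ceil_iff.2 hX, Nat.le_ceil X, (Nat.ceil_lt_add_one hX.le).le⟩

lemma abs_stieltjes_zero_le {g₀ : ℝ}
    (hg₀ : ∀ N : ℕ, 1 ≤ N → |∑ n ∈ Finset.Icc 1 N, 1 / (n : ℝ) - Real.log (N + 1 / 2) - g₀|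
      ≤ 1 / (4 * (N : ℝ) ^ 2)) :
    |g₀| ≤ 1 := by
  have h := hg₀ 1 le_rfl
  have h1 := Real.log_le_sub_one_of_pos (by norm_num : (0 : ℝ) < 1 + 1 / 2)
  have h2 := Real.log_nonneg (by norm_num : (1 : ℝ) ≤ 1 + 1 / 2)
  have h3 := Real.one_sub_inv_le_log_of_pos (by norm_num : (0 : ℝ) < 1 + 1 / 2)
  norm_num at h h1 h2 h3
  rw [abs_le] at *
  constructor <;> linarith [h.1, h.2]

lemma abs_stieltjes_one_le {g₁ : ℝ}
    (hg₁ : ∀ N : ℕ, 1 ≤ N →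
      |∑ n ∈ Finset.Icc 1 N, Real.log n / (n : ℝ) - Real.log (N + 1 / 2) ^ 2 / 2 - g₁|
        ≤ (3 / 4) / (N : ℝ)) :
    |g₁| ≤ 1 := by
  have h := hg₁ 1 le_rfl
  have h1 := Real.log_le_sub_one_of_pos (by norm_num : (0 : ℝ) < 1 + 1 / 2)
  have h2 := Real.log_nonneg (by norm_num : (1 : ℝ) ≤ 1 + 1 / 2)
  norm_num at h h1 h2
  rw [abs_le] at *
  constructor <;> nlinarith [h.1, h.2]

lemma exists_abs_TkErr_two_le {g₀ g₁ g₂ : ℝ}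
    (hg₀ : ∀ N : ℕ, 1 ≤ N → |∑ n ∈ Finset.Icc 1 N, 1 / (n : ℝ) - Real.log (N + 1 / 2) - g₀|
      ≤ 1 / (4 * (N : ℝ) ^ 2))
    (hg₁ : ∀ N : ℕ, 1 ≤ N →
      |∑ n ∈ Finset.Icc 1 N, Real.log n / (n : ℝ) - Real.log (N + 1 / 2) ^ 2 / 2 - g₁|
        ≤ (3 / 4) / (N : ℝ))
    (hg₂ : ∀ N : ℕ, 1 ≤ N →
      |∑ n ∈ Finset.Icc 1 N, Real.log n ^ 2 / (n : ℝ) - Real.log (N + 1 / 2) ^ 3 / 3 - g₂|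
        ≤ (5 / 2) / (N : ℝ)) :
    ∃ p : ℝ, |p| ≤ 2 ∧ ∀ u, 1 ≤ u → |TkErr 2 0 1 p u| ≤ 4 * u ^ (1 / 2 : ℝ) := by
  have hint : IntegrableOn (fun u => TkErr 1 0 0 1 u / u ^ 2) (Set.Ioi 1) :=
    integrableOn_Ioi_TkErr_div_sq le_rfl zero_lt_one
      fun u hu => abs_TkErr_one_le (zero_le_one.trans hu)
  have hC := abs_integral_Ioi_TkErr_div_sq_le (k := 1) (a := 0) (b := 0) (c := 1) le_rfl zero_lt_one
      fun u hu => abs_TkErr_one_le (zero_le_one.trans hu)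
  norm_num at hC
  have hg := abs_stieltjes_zero_le hg₀
  refine ⟨(∫ u in Set.Ioi 1, TkErr 1 0 0 1 u / u ^ 2) + g₀, ?_, fun x hx => ?_⟩
  · rw [abs_le] at *
    constructor <;> linarith [hC.1, hC.2, hg.1, hg.2]
  have hx0 : 0 < x := by linarith
  rw [← Real.sqrt_eq_rpow]
  set r := √x with hr
  have hr2 : r ^ 2 = x := Real.sq_sqrt hx0.le
  have hr1 : 1 ≤ r := Real.one_le_sqrt.2 hx
  rcases le_or_gt (3 / 2) x with h | h
  · have hN : 1 ≤ ⌊r⌋₊ := (Nat.one_le_floor_iff r).2 hr1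
    have hN1 := Nat.floor_le (by linarith : 0 ≤ r)
    have hN2 := Nat.lt_floor_add_one r
    have hNx : (⌊r⌋₊ : ℝ) + 1 / 2 ≤ x := by
      rcases hN.eq_or_lt with h1 | h1
      · rw [← h1]; norm_num; exact h
      · have : (2 : ℝ) ≤ ⌊r⌋₊ := by exact_mod_cast h1
        nlinarith
    have := abs_Tk_succ_sub_le hg₀ hg₁ hg₂ hint hN hNx le_rfl zero_lt_one zero_le_one
      fun u hu => abs_TkErr_one_le ((div_nonneg hx0.le (by positivity)).trans hu)
    set M : ℝ := (⌊r⌋₊ : ℝ) with hM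
    have hM1 : (1 : ℝ) ≤ M := by rw [hM]; exact_mod_cast hN
    have t1 : Tk 1 (x / (M + 1 / 2)) ≤ x / (M + 1 / 2) := by
      rw [Tk_one]; exact Nat.floor_le (by positivity)
    have t2 : x / (M + 1 / 2) ≤ 4 / 3 * r := by
      rw [div_le_iff₀ (by linarith), ← hr2]
      nlinarith
    have t3 : x / (4 * M ^ 2) ≤ r / 2 := by
      rw [div_le_iff₀ (by positivity), ← hr2]
      nlinarith [mul_nonneg (by linarith : 0 ≤ M - 1) (by linarith : 0 ≤ M)]
    have t4 : 6 / 5 ≤ r := by nlinarith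
    have e : x * (|0 * Real.log x ^ 2 + 0 * Real.log x + 1| / (4 * M ^ 2) +
        |2 * 0 * Real.log x + 0| * ((3 / 4) / M) + |(0 : ℝ)| * ((5 / 2) / M)) =
        x / (4 * M ^ 2) := by
      norm_num
      ring
    rw [e, Real.rpow_zero, sub_zero, Real.rpow_one] at this
    rw [TkErr]
    norm_num at this ⊢
    refine this.trans ?_
    norm_num at t1 t2 t3 t4 ⊢
    linarith
  · have hT : Tk 2 x = 1 := by
      have : ⌊x⌋₊ = 1 := (Nat.floor_eq_iff hx0.le).2 ⟨by simpa using hx, by norm_num; linarith⟩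
      simp [Tk, this, dk, pow_two, ArithmeticFunction.mul_apply]
    have hl1 := Real.log_nonneg hx
    have hl2 := Real.log_le_sub_one_of_pos hx0
    have hr3 : r ≤ 5 / 4 := by nlinarith
    have hxr : x ≤ 5 / 4 * r := by nlinarith
    have hp : |(∫ u in Set.Ioi 1, TkErr 1 0 0 1 u / u ^ 2) + g₀| ≤ 2 := by
      rw [abs_le] at *
      constructor <;> linarith [hC.1, hC.2, hg.1, hg.2]
    set p := (∫ u in Set.Ioi 1, TkErr 1 0 0 1 u / u ^ 2) + g₀
    rw [abs_le] at hp
    have q1 : x * (Real.log x + p) ≤ x * (5 / 2) :=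
      mul_le_mul_of_nonneg_left (by linarith) hx0.le
    have q2 : x * (-2) ≤ x * (Real.log x + p) :=
      mul_le_mul_of_nonneg_left (by linarith) hx0.le
    rw [TkErr, hT, abs_le, zero_mul, zero_add, one_mul]
    constructor <;> linarith

set_option maxHeartbeats 1000000 in
lemma exists_abs_TkErr_three_le {g₀ g₁ g₂ : ℝ}
    (hg₀ : ∀ N : ℕ, 1 ≤ N → |∑ n ∈ Finset.Icc 1 N, 1 / (n : ℝ) - Real.log (N + 1 / 2) - g₀|
      ≤ 1 / (4 * (N : ℝ) ^ 2))
    (hg₁ : ∀ N : ℕ, 1 ≤ N →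
      |∑ n ∈ Finset.Icc 1 N, Real.log n / (n : ℝ) - Real.log (N + 1 / 2) ^ 2 / 2 - g₁|
        ≤ (3 / 4) / (N : ℝ))
    (hg₂ : ∀ N : ℕ, 1 ≤ N →
      |∑ n ∈ Finset.Icc 1 N, Real.log n ^ 2 / (n : ℝ) - Real.log (N + 1 / 2) ^ 3 / 3 - g₂|
        ≤ (5 / 2) / (N : ℝ)) :
    ∃ b c : ℝ, |b| ≤ 3 ∧ |c| ≤ 12 ∧ ∀ x, Real.exp 20 ≤ x →
      |TkErr 3 (1 / 2) b c x| ≤ 10 * (x ^ (2 / 3 : ℝ) * Real.log x ^ (1 / 3 : ℝ)) := by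
  obtain ⟨p, hp, hE⟩ := exists_abs_TkErr_two_le hg₀ hg₁ hg₂
  have hint : IntegrableOn (fun u => TkErr 2 0 1 p u / u ^ 2) (Set.Ioi 1) :=
    integrableOn_Ioi_TkErr_div_sq le_rfl (by norm_num) hE
  have hC := abs_integral_Ioi_TkErr_div_sq_le le_rfl (by norm_num) hE
  norm_num at hC
  have hg0 := abs_stieltjes_zero_le hg₀
  have hg1 := abs_stieltjes_one_le hg₁
  have hgp : |g₀ * p| ≤ 2 := by
    rw [abs_mul]; nlinarith [abs_nonneg g₀, abs_nonneg p]
  refine ⟨p + g₀, (∫ u in Set.Ioi 1, TkErr 2 0 1 p u / u ^ 2) + g₀ * p - g₁, ?_, ?_,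
    fun x hx => ?_⟩
  · exact (abs_add_le _ _).trans (by linarith)
  · rw [abs_le] at *
    constructor <;> linarith [hC.1, hC.2, hgp.1, hgp.2, hg1.1, hg1.2]
  have hx0 : 0 < x := (Real.exp_pos _).trans_le hx
  set L := Real.log x with hL
  have hL20 : 20 ≤ L := by rw [hL, Real.le_log_iff_exp_le hx0]; exact hx
  have hxL : x = Real.exp L := (Real.exp_log hx0).symm
  obtain ⟨w, hw⟩ : ∃ w, w = Real.exp (L / 3) := ⟨_, rfl⟩
  obtain ⟨l, hl⟩ : ∃ l, l = L ^ (1 / 3 : ℝ) := ⟨_, rfl⟩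
  have hl0 : 0 < l := by rw [hl]; positivity
  have hl3 : l ^ 3 = L := by
    rw [hl, ← Real.rpow_natCast, ← Real.rpow_mul (by linarith)]; norm_num
  have hl7 : 7 ≤ l ^ 2 := by
    by_contra! h
    have : (l ^ 2) ^ 3 < 7 ^ 3 := by gcongr
    have e : (l ^ 2) ^ 3 = L ^ 2 := by rw [← hl3]; ring
    rw [e] at this
    nlinarith
  have hw3 : w ^ 3 = x := by
    rw [hw, ← Real.exp_nat_mul, hxL]; congr 1; push_cast; ring
  have hx23 : x ^ (2 / 3 : ℝ) = w ^ 2 := by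
    rw [hw, ← Real.exp_nat_mul, hxL, ← Real.exp_mul]; congr 1; push_cast; ring
  have hw380 : 380 ≤ w := by
    have h1 : Real.exp 6 ≤ w := by rw [hw]; gcongr; linarith
    have h2 : Real.exp 6 = Real.exp 1 ^ 6 := by rw [← Real.exp_nat_mul]; norm_num
    have h3 : (2.7 : ℝ) ^ 6 ≤ Real.exp 1 ^ 6 := by
      gcongr; linarith [Real.exp_one_gt_d9]
    norm_num at h3
    linarith
  have hw0 : 0 < w := by linarith
  obtain ⟨X, hX⟩ : ∃ X, X = w * l ^ 2 / 7 := ⟨_, rfl⟩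
  have hXw : w ≤ X := by rw [hX, le_div_iff₀ (by norm_num)]; nlinarith
  have hX0 : 0 < X := by linarith
  obtain ⟨hN, hN1, hN2⟩ := le_ceil_of_pos hX0
  have hXX : X + 3 / 2 ≤ x := by
    have : l ≤ w := by
      have h1 : L / 3 + 1 ≤ w := by rw [hw]; exact Real.add_one_le_exp _
      nlinarith
    rw [← hw3, hX]
    nlinarith [mul_le_mul this this hl0.le hw0.le, mul_pos hw0 hw0]
  have hNx : (⌈X⌉₊ : ℝ) + 1 / 2 ≤ x := by linarith
  have hB1 : 1 ≤ x / ((⌈X⌉₊ : ℝ) + 1 / 2) := by rw [le_div_iff₀ (by positivity)]; linarith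
  have := abs_Tk_succ_sub_le hg₀ hg₁ hg₂ hint hN hNx (by norm_num) (by norm_num) (by norm_num)
      fun u hu => hE u (hB1.trans hu)
  obtain ⟨M, hM⟩ : ∃ M : ℝ, M = (⌈X⌉₊ : ℝ) := ⟨_, rfl⟩
  rw [← hM] at this hN1 hN2 hB1
  have hM0 : 0 < M := by linarith
  have hxX : x / X = 7 * w ^ 2 / l ^ 2 := by rw [hX, ← hw3]; field_simp
  have hwl : 0 < w ^ 2 * l := by positivity
  have hL0 : 7 * w ^ 2 / l ^ 2 * L = 7 * (w ^ 2 * l) := by rw [← hl3]; field_simp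
  have hxM : x / M ≤ 7 * w ^ 2 / l ^ 2 := by rw [← hxX]; gcongr
  have hB2 : x / (M + 1 / 2) ≤ 7 * w ^ 2 / l ^ 2 := by rw [← hxX]; gcongr; linarith
  have E1 : 2 * 4 / (1 - 1 / 2) * (x ^ (1 / 2 : ℝ) * (M + 1 / 2) ^ (1 - 1 / 2 : ℝ)) ≤
      6.1 * (w ^ 2 * l) := by
    rw [show (1 - 1 / 2 : ℝ) = 1 / 2 by norm_num, ← Real.mul_rpow hx0.le (by linarith),
      ← Real.sqrt_eq_rpow]
    have : √(x * (M + 1 / 2)) ≤ 6.1 / 16 * (w ^ 2 * l) := by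
      rw [Real.sqrt_le_left (by positivity)]
      calc x * (M + 1 / 2) ≤ w ^ 3 * (w * l ^ 2 / 7 + 3 / 2) := by
            rw [hw3, ← hX]; exact mul_le_mul_of_nonneg_left (by linarith) hx0.le
        _ ≤ _ := by
            have h1 : 380 * 7 ≤ w * l ^ 2 := by gcongr
            rw [show (6.1 / 16 * (w ^ 2 * l)) ^ 2 = w ^ 3 * ((6.1 / 16) ^ 2 * (w * l ^ 2)) by ring]
            refine mul_le_mul_of_nonneg_left ?_ (by positivity)
            norm_num
            linarith
    linarith
  have E2 : Tk 2 (x / (M + 1 / 2)) / 2 ≤ 2.51 * (w ^ 2 * l) := by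
    have h1 := Tk_succ_le 1 hB1
    have h2 : Real.log (x / (M + 1 / 2)) ≤ 2 / 3 * L := by
      have h3 : x / (M + 1 / 2) ≤ w ^ 2 := by
        rw [div_le_iff₀ (by linarith), ← hw3, pow_succ w 2]
        exact mul_le_mul_of_nonneg_left (by linarith) (by positivity)
      calc _ ≤ Real.log (w ^ 2) := Real.log_le_log (by linarith) h3
        _ = _ := by rw [Real.log_pow, hw, Real.log_exp]; push_cast; ring
    have h4 : x / (M + 1 / 2) * (1 + Real.log (x / (M + 1 / 2))) ^ 1 ≤
        7 * w ^ 2 / l ^ 2 * (43 / 60 * L) := by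
      rw [pow_one]
      have := Real.log_nonneg hB1
      gcongr
      linarith
    have h5 : Tk 2 (x / (M + 1 / 2)) ≤ 7 * w ^ 2 / l ^ 2 * (43 / 60 * L) := h1.trans h4
    have e : 7 * w ^ 2 / l ^ 2 * (43 / 60 * L) = 43 / 60 * (7 * (w ^ 2 * l)) := by
      rw [← hL0]; ring
    rw [e] at h5
    linarith
  have E3 : x * (|0 * L ^ 2 + 1 * L + p| / (4 * M ^ 2) + |2 * 0 * L + 1| * ((3 / 4) / M) +
      |(0 : ℝ)| * ((5 / 2) / M)) ≤ 0.5 * (w ^ 2 * l) := by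
    have e : x * (|0 * L ^ 2 + 1 * L + p| / (4 * M ^ 2) + |2 * 0 * L + 1| * ((3 / 4) / M) +
      |(0 : ℝ)| * ((5 / 2) / M)) = x / M * (|L + p| / (4 * M) + 3 / 4) := by
      norm_num
      field_simp
    rw [e]
    have h1 : |L + p| ≤ 1.1 * L := by
      rw [abs_le] at *
      constructor <;> linarith [hp.1, hp.2]
    have h2 : |L + p| / (4 * M) ≤ 1 / 1000 * L := by
      rw [div_le_iff₀ (by linarith)]
      have := mul_le_mul_of_nonneg_left (by linarith : 380 ≤ M) (by linarith : 0 ≤ L)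
      linarith
    calc x / M * (|L + p| / (4 * M) + 3 / 4) ≤ 7 * w ^ 2 / l ^ 2 * (0.05 * L) := by
          gcongr
          linarith
      _ = 0.05 * (7 * (w ^ 2 * l)) := by rw [← hL0]; ring
      _ ≤ _ := by linarith
  have e : x * (1 / 2 * L ^ 2 + (p + g₀) * L +
      ((∫ u in Set.Ioi 1, TkErr 2 0 1 p u / u ^ 2) + g₀ * p - g₁)) =
      x * (0 / 3 * L ^ 3 + (1 / 2 + g₀ * 0) * L ^ 2 +
        (p + g₀ * 1 - 2 * g₁ * 0) * L +
        ((∫ u in Set.Ioi 1, TkErr 2 0 1 p u / u ^ 2) + g₀ * p - g₁ * 1 + g₂ * 0)) := by ring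
  rw [hx23, ← hl, TkErr, ← hL, e]
  refine this.trans ?_
  linarith

lemma rpow_mul_log_rpow_le {B u : ℝ} (hB : Real.exp 20 ≤ B) (hu : B ≤ u) :
    u ^ (2 / 3 : ℝ) * Real.log u ^ (1 / 3 : ℝ) ≤
      (Real.log B ^ (1 / 3 : ℝ) * B ^ (-(1 / 60) : ℝ)) * u ^ (41 / 60 : ℝ) := by
  have hB0 : 0 < B := (Real.exp_pos _).trans_le hB
  have hu0 : 0 < u := hB0.trans_le hu
  have hlB : 20 ≤ Real.log B := (Real.le_log_iff_exp_le hB0).2 hB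
  have hlu : Real.log B ≤ Real.log u := Real.log_le_log hB0 hu
  have h1 : Real.log u ≤ Real.log B * (u / B) ^ (1 / 20 : ℝ) := by
    rw [Real.rpow_def_of_pos (by positivity), Real.log_div hu0.ne' hB0.ne']
    have := Real.add_one_le_exp ((Real.log u - Real.log B) * (1 / 20))
    nlinarith
  have h2 : Real.log u ^ (1 / 3 : ℝ) ≤ Real.log B ^ (1 / 3 : ℝ) * (u / B) ^ (1 / 60 : ℝ) := by
    calc _ ≤ (Real.log B * (u / B) ^ (1 / 20 : ℝ)) ^ (1 / 3 : ℝ) :=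
          Real.rpow_le_rpow (by linarith) h1 (by norm_num)
      _ = _ := by
          rw [Real.mul_rpow (by linarith) (by positivity), ← Real.rpow_mul (by positivity)]
          norm_num
  calc _ ≤ u ^ (2 / 3 : ℝ) * (Real.log B ^ (1 / 3 : ℝ) * (u / B) ^ (1 / 60 : ℝ)) := by gcongr
    _ = _ := by
      rw [Real.div_rpow hu0.le hB0.le, Real.rpow_neg hB0.le,
        show (41 / 60 : ℝ) = 2 / 3 + 1 / 60 by norm_num, Real.rpow_add hu0]
      field_simp

lemma abs_quadratic_div_add_le {b c L M : ℝ} (hb : |b| ≤ 3) (hc : |c| ≤ 12) (hL : 32 ≤ L)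
    (hM : 250 ≤ M) :
    |1 / 2 * L ^ 2 + b * L + c| / (4 * M) + 3 / 4 * |L + b| + 5 / 4 ≤ 0.05 * L ^ 2 := by
  rw [abs_le] at hb hc
  have h1 : |L + b| ≤ L ^ 2 / 25 := by
    rw [abs_le]
    constructor <;> nlinarith
  have h2 : |1 / 2 * L ^ 2 + b * L + c| ≤ L ^ 2 := by
    rw [abs_le]
    constructor <;> nlinarith
  have h3 : |1 / 2 * L ^ 2 + b * L + c| / (4 * M) ≤ 1 / 1000 * L ^ 2 := by
    rw [div_le_iff₀ (by linarith)]
    nlinarith [sq_nonneg L]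
  have h4 : 1024 ≤ L ^ 2 := by nlinarith
  norm_num at h1 h2 h3 ⊢
  linarith

set_option maxHeartbeats 1000000 in
lemma exists_abs_TkErr_four_le : ∃ a b c : ℝ, ∀ x, Real.exp 32 ≤ x →
    |Tk 4 x - x * (1 / 6 * Real.log x ^ 3 + a * Real.log x ^ 2 + b * Real.log x + c)| <
      33.480 * (x ^ (3 / 4 : ℝ) * Real.log x ^ (3 / 4 : ℝ)) := by
  obtain ⟨g₀, hg₀⟩ := exists_abs_sum_one_div_sub_log_le
  obtain ⟨g₁, hg₁⟩ := exists_abs_sum_log_div_sub_le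
  obtain ⟨g₂, hg₂⟩ := exists_abs_sum_log_sq_div_sub_le
  obtain ⟨b, c, hb, hc, hE⟩ := exists_abs_TkErr_three_le hg₀ hg₁ hg₂
  have hE' : ∀ B, Real.exp 20 ≤ B → ∀ u, B ≤ u → |TkErr 3 (1 / 2) b c u| ≤
      (10 * (Real.log B ^ (1 / 3 : ℝ) * B ^ (-(1 / 60) : ℝ))) * u ^ (41 / 60 : ℝ) := by
    intro B hB u hu
    rw [mul_assoc]
    refine (hE u (hB.trans hu)).trans ?_
    have := rpow_mul_log_rpow_le hB hu
    gcongr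
  have hint : IntegrableOn (fun u => TkErr 3 (1 / 2) b c u / u ^ 2) (Set.Ioi 1) :=
    integrableOn_Ioi_TkErr_div_sq (Real.one_le_exp (by norm_num)) (by norm_num) (hE' _ le_rfl)
  refine ⟨b / 2 + g₀ * (1 / 2), c + g₀ * b - 2 * g₁ * (1 / 2),
    (∫ u in Set.Ioi 1, TkErr 3 (1 / 2) b c u / u ^ 2) + g₀ * c - g₁ * b + g₂ * (1 / 2),
    fun x hx => ?_⟩
  have hx0 : 0 < x := (Real.exp_pos _).trans_le hx
  have hL32 : 32 ≤ Real.log x := (Real.le_log_iff_exp_le hx0).2 hx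
  obtain ⟨L, hL⟩ : ∃ L, L = Real.log x := ⟨_, rfl⟩
  rw [← hL] at hL32
  have hxL : x = Real.exp L := by rw [hL, Real.exp_log hx0]
  obtain ⟨w, hw⟩ : ∃ w, w = Real.exp (L / 4) := ⟨_, rfl⟩
  obtain ⟨l, hl⟩ : ∃ l, l = L ^ (1 / 4 : ℝ) := ⟨_, rfl⟩
  have hl0 : 0 < l := by rw [hl]; positivity
  have hl4 : l ^ 4 = L := by
    rw [hl, ← Real.rpow_natCast, ← Real.rpow_mul (by linarith)]; norm_num
  have hl34 : L ^ (3 / 4 : ℝ) = l ^ 3 := by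
    rw [hl, ← Real.rpow_natCast, ← Real.rpow_mul (by linarith)]; norm_num
  have hl2 : 2 ≤ l := by
    by_contra! h
    have : l ^ 4 < 2 ^ 4 := by gcongr
    linarith
  have hl5 : 64 ≤ l ^ 5 := by
    have : l ^ 5 = L * l := by rw [← hl4]; ring
    nlinarith
  have hw4 : w ^ 4 = x := by
    rw [hw, ← Real.exp_nat_mul, hxL]; congr 1; push_cast; ring
  have hx34 : x ^ (3 / 4 : ℝ) = w ^ 3 := by
    rw [hw, ← Real.exp_nat_mul, hxL, ← Real.exp_mul]; congr 1; push_cast; ring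
  have hw2800 : 2800 ≤ w := by
    have h1 : Real.exp 8 ≤ w := by rw [hw]; gcongr; linarith
    have h2 : Real.exp 8 = Real.exp 1 ^ 8 := by rw [← Real.exp_nat_mul]; norm_num
    have h3 : (2.7 : ℝ) ^ 8 ≤ Real.exp 1 ^ 8 := by
      gcongr; linarith [Real.exp_one_gt_d9]
    norm_num at h3
    linarith
  have hw0 : 0 < w := by linarith
  obtain ⟨X, hX⟩ : ∃ X, X = w * l ^ 5 / 24 := ⟨_, rfl⟩
  have hXw : 2 * w ≤ X := by rw [hX, le_div_iff₀ (by norm_num)]; nlinarith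
  have hX0 : 0 < X := by linarith
  obtain ⟨hN, hN1, hN2⟩ := le_ceil_of_pos hX0
  have hXexp : X + 3 / 2 ≤ Real.exp (3 * L / 8) := by
    have h1 : (L / 8) ^ 2 / 2 ≤ Real.exp (L / 8) := by
      have := Real.quadratic_le_exp_of_nonneg (by linarith : 0 ≤ L / 8)
      linarith
    have h2 : 2 ≤ Real.exp (L / 8) := by nlinarith
    have h3 : Real.exp (3 * L / 8) = w * Real.exp (L / 8) := by
      rw [hw, ← Real.exp_add]; congr 1; ring
    have h4 : 8 * l ^ 5 ≤ L ^ 2 := by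
      have e : L ^ 2 = l ^ 3 * l ^ 5 := by rw [← hl4]; ring
      have : 2 ^ 3 ≤ l ^ 3 := by gcongr
      rw [e]
      nlinarith
    have h5 : l ^ 5 / 24 ≤ 2 / 3 * Real.exp (L / 8) := by nlinarith
    have h6 : X ≤ w * (2 / 3 * Real.exp (L / 8)) := by rw [hX, mul_div_assoc]; gcongr
    rw [h3]
    nlinarith
  have hNx : (⌈X⌉₊ : ℝ) + 1 / 2 ≤ x := by
    have : Real.exp (3 * L / 8) ≤ x := by rw [hxL]; gcongr; linarith
    linarith
  have hB20 : Real.exp 20 ≤ x / ((⌈X⌉₊ : ℝ) + 1 / 2) := by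
    rw [le_div_iff₀ (by positivity)]
    calc Real.exp 20 * ((⌈X⌉₊ : ℝ) + 1 / 2) ≤ Real.exp (5 * L / 8) * Real.exp (3 * L / 8) := by
          gcongr <;> linarith
      _ = x := by rw [← Real.exp_add, hxL]; congr 1; ring
  have hB0 := (Real.exp_pos 20).trans_le hB20
  have hlog0 := Real.log_nonneg ((Real.one_le_exp (by norm_num)).trans hB20)
  have hD0 : 0 ≤ 10 * (Real.log (x / ((⌈X⌉₊ : ℝ) + 1 / 2)) ^ (1 / 3 : ℝ) *
      (x / ((⌈X⌉₊ : ℝ) + 1 / 2)) ^ (-(1 / 60) : ℝ)) := by positivity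
  have := abs_Tk_succ_sub_le hg₀ hg₁ hg₂ hint hN hNx (by norm_num) (by norm_num) hD0
      (hE' _ hB20)
  obtain ⟨M, hM⟩ : ∃ M : ℝ, M = (⌈X⌉₊ : ℝ) := ⟨_, rfl⟩
  rw [← hM] at this hN1 hN2 hB20
  have hM0 : 0 < M := by linarith
  have hB1 : 1 ≤ x / (M + 1 / 2) := (Real.one_le_exp (by norm_num)).trans hB20
  have hxX : x / X = 24 * w ^ 3 / l ^ 5 := by rw [hX, ← hw4]; field_simp
  have hwl : 0 < w ^ 3 * l ^ 3 := by positivity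
  have hL0 : 24 * w ^ 3 / l ^ 5 * L ^ 2 = 24 * (w ^ 3 * l ^ 3) := by rw [← hl4]; field_simp
  have hxM : x / M ≤ 24 * w ^ 3 / l ^ 5 := by rw [← hxX]; gcongr
  have hB2 : x / (M + 1 / 2) ≤ 24 * w ^ 3 / l ^ 5 := by rw [← hxX]; gcongr; linarith
  have hlogB : Real.log (x / (M + 1 / 2)) ≤ 3 / 4 * L := by
    have h3 : x / (M + 1 / 2) ≤ w ^ 3 := by
      rw [div_le_iff₀ (by linarith), ← hw4, pow_succ w 3]
      exact mul_le_mul_of_nonneg_left (by linarith) (by positivity)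
    calc _ ≤ Real.log (w ^ 3) := Real.log_le_log (by linarith) h3
      _ = _ := by rw [Real.log_pow, hw, Real.log_exp]; push_cast; ring
  have hlogB0 := Real.log_nonneg hB1
  have E1 : 2 * (10 * (Real.log (x / (M + 1 / 2)) ^ (1 / 3 : ℝ) *
      (x / (M + 1 / 2)) ^ (-(1 / 60) : ℝ))) / (1 - 41 / 60) *
      (x ^ (41 / 60 : ℝ) * (M + 1 / 2) ^ (1 - 41 / 60 : ℝ)) ≤ 20.5 * (w ^ 3 * l ^ 3) := by
    have hA0 : 0 < M + 1 / 2 := by linarith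
    have e : (x / (M + 1 / 2)) ^ (-(1 / 60) : ℝ) *
        (x ^ (41 / 60 : ℝ) * (M + 1 / 2) ^ (1 - 41 / 60 : ℝ)) =
        (x ^ 2 * (M + 1 / 2)) ^ (1 / 3 : ℝ) := by
      rw [Real.div_rpow hx0.le hA0.le, Real.mul_rpow (by positivity) hA0.le, ← Real.rpow_natCast,
        ← Real.rpow_mul hx0.le, show (1 - 41 / 60 : ℝ) = 1 / 3 + -(1 / 60) by norm_num,
        Real.rpow_add hA0, show (41 / 60 : ℝ) = 2 / 3 + 1 / 60 by norm_num, Real.rpow_add hx0,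
        Real.rpow_neg hx0.le]
      norm_num
      field_simp
    have h1 : 2 * (10 * (Real.log (x / (M + 1 / 2)) ^ (1 / 3 : ℝ) *
        (x / (M + 1 / 2)) ^ (-(1 / 60) : ℝ))) / (1 - 41 / 60) *
        (x ^ (41 / 60 : ℝ) * (M + 1 / 2) ^ (1 - 41 / 60 : ℝ)) =
        1200 / 19 * (Real.log (x / (M + 1 / 2)) * (x ^ 2 * (M + 1 / 2))) ^ (1 / 3 : ℝ) := by
      rw [Real.mul_rpow hlogB0 (by positivity), ← e]
      ring
    have h2 : Real.log (x / (M + 1 / 2)) * (x ^ 2 * (M + 1 / 2)) ≤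
        (0.32 * (w ^ 3 * l ^ 3)) ^ 3 := by
      calc _ ≤ 3 / 4 * l ^ 4 * ((w ^ 4) ^ 2 * (w * l ^ 5 / 24 + 3 / 2)) := by
            rw [hl4, hw4, ← hX]
            have hMX : M + 1 / 2 ≤ X + 3 / 2 := by linarith
            exact mul_le_mul hlogB (mul_le_mul_of_nonneg_left hMX (by positivity))
              (by positivity) (by linarith)
        _ ≤ 3 / 4 * l ^ 4 * ((w ^ 4) ^ 2 * (w * l ^ 5 / 24 * 1.01)) := by
            gcongr
            linarith
        _ = 3 / 4 / 24 * 1.01 * (w ^ 3 * l ^ 3) ^ 3 := by ring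
        _ ≤ 0.32 ^ 3 * (w ^ 3 * l ^ 3) ^ 3 := by gcongr; norm_num
        _ = _ := by ring
    have h3 : (Real.log (x / (M + 1 / 2)) * (x ^ 2 * (M + 1 / 2))) ^ (1 / 3 : ℝ) ≤
        0.32 * (w ^ 3 * l ^ 3) := by
      calc _ ≤ ((0.32 * (w ^ 3 * l ^ 3)) ^ 3) ^ (1 / 3 : ℝ) :=
            Real.rpow_le_rpow (by positivity) h2 (by norm_num)
        _ = _ := by
            rw [← Real.rpow_natCast, ← Real.rpow_mul (by positivity)]
            norm_num
    rw [h1]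
    linarith
  have E2 : Tk 3 (x / (M + 1 / 2)) / 2 ≤ 7.5 * (w ^ 3 * l ^ 3) := by
    have h1 := Tk_succ_le 2 hB1
    have h4 : x / (M + 1 / 2) * (1 + Real.log (x / (M + 1 / 2))) ^ 2 ≤
        24 * w ^ 3 / l ^ 5 * (25 / 32 * L) ^ 2 := by
      gcongr
      linarith
    have h5 : Tk 3 (x / (M + 1 / 2)) ≤ 24 * w ^ 3 / l ^ 5 * (25 / 32 * L) ^ 2 := h1.trans h4
    have e : 24 * w ^ 3 / l ^ 5 * (25 / 32 * L) ^ 2 = (25 / 32) ^ 2 * (24 * (w ^ 3 * l ^ 3)) := by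
      rw [← hL0]; ring
    rw [e] at h5
    linarith
  have E3 : x * (|1 / 2 * L ^ 2 + b * L + c| / (4 * M ^ 2) +
      |2 * (1 / 2) * L + b| * ((3 / 4) / M) + |(1 / 2 : ℝ)| * ((5 / 2) / M)) ≤
      2 * (w ^ 3 * l ^ 3) := by
    have e : x * (|1 / 2 * L ^ 2 + b * L + c| / (4 * M ^ 2) +
      |2 * (1 / 2) * L + b| * ((3 / 4) / M) + |(1 / 2 : ℝ)| * ((5 / 2) / M)) =
      x / M * (|1 / 2 * L ^ 2 + b * L + c| / (4 * M) + 3 / 4 * |L + b| + 5 / 4) := by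
      rw [abs_of_pos (by norm_num : (0 : ℝ) < 1 / 2), show (2 : ℝ) * (1 / 2) * L = L by ring]
      field_simp
      ring
    rw [e]
    calc _ ≤ 24 * w ^ 3 / l ^ 5 * (0.05 * L ^ 2) :=
          mul_le_mul hxM (abs_quadratic_div_add_le hb hc hL32 (by linarith)) (by positivity)
            (by positivity)
      _ = 0.05 * (24 * (w ^ 3 * l ^ 3)) := by rw [← hL0]; ring
      _ ≤ _ := by linarith
  rw [← hL] at this ⊢
  rw [hx34, hl34, show (1 / 6 : ℝ) = 1 / 2 / 3 by norm_num]
  refine this.trans_lt ?_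
  linarith

theorem stmt_3 :
    ∃ P : Polynomial ℝ, P.natDegree ≤ 3 ∧ P.coeff 3 = 1 / 6 ∧
      ∀ x : ℝ, Real.exp 32 ≤ x →
        |Tk 4 x - x * P.eval (Real.log x)|
          < 33.480 * x ^ ((3 : ℝ) / 4) * Real.log x ^ ((3 : ℝ) / 4) := by
  obtain ⟨a, b, c, h⟩ := exists_abs_TkErr_four_le
  refine ⟨Polynomial.C (1 / 6) * Polynomial.X ^ 3 + Polynomial.C a * Polynomial.X ^ 2 +
    Polynomial.C b * Polynomial.X + Polynomial.C c, Polynomial.natDegree_cubic_le, ?_,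
    fun x hx => ?_⟩
  · simp
  · rw [mul_assoc]
    simpa using h x hx
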